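/- Let M > 0 and l > 0. There exists a₀ > 0, depending only on M and l, such that for every a with 0 < a < a₀ and every r_h > 0 satisfying Δ₋(r_h) = 0 and a·l < r_h², the following holds for all r ≥ r_h, all θ ∈ (0, π), and all real numbers X, Y: (1/2)(−G)X² − G·(2aΞ/(r_h² + a²))·X·Y + (1/8)·(Ξ²/(Δ_θ Σ sin²θ))·Y² ≥ 0, where G = −[Ξ Δ₊ + a² sin²θ(−k₀Ξ + 2Mr/l²)]/(k₀² Δ_θ Σ), Δ₊ = (r² + a²)(1 + r²/l²) + 2Mr, Ξ = 1 − a²/l², k₀ = 1 + r²/l², Δ_θ = 1 − (a²/l²)cos²θ, and Σ = r² + a²cos²θ. -/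

import Mathlib

/-- A binary quadratic form with nonnegative leading coefficient and dominated cross term is
nonnegative. -/
lemma quadratic_form_nonneg {H P w : ℝ} (hH : 0 ≤ H) (hP : 4 * H * w ^ 2 ≤ P) (X Y : ℝ) :
    0 ≤ (1 / 2) * (- -H) * X ^ 2 - (-H) * w * X * Y + (1 / 8) * P * Y ^ 2 := by
  have h₁ : 0 ≤ H * (X + w * Y) ^ 2 := by positivity
  have h₂ : 0 ≤ (P - 4 * H * w ^ 2) * Y ^ 2 := mul_nonneg (by linarith) (sq_nonneg Y)
  linarith

/-- A root `r` of `Δ₋` with `a l < r²` is bounded below independently of `a`. -/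
lemma min_le_horizon_radius {M l a r : ℝ} (hl : 0 < l) (ha : 0 < a) (hr : 0 < r)
    (hΔ : (r ^ 2 + a ^ 2) * (1 + r ^ 2 / l ^ 2) - 2 * M * r = 0) (hal : a * l < r ^ 2) :
    min l (M / 2) ≤ r := by
  rcases le_or_gt l r with h | h
  · exact (min_le_left _ _).trans h
  · refine (min_le_right _ _).trans ?_
    have hk : r ^ 2 / l ^ 2 ≤ 1 := by
      rw [div_le_one (by positivity)]
      gcongr
    have har : a < r := by
      by_contra! hra
      nlinarith [mul_le_mul hra h.le hr.le ha.le]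
    have h₁ : a ^ 2 ≤ r ^ 2 := by gcongr
    have h₂ : (r ^ 2 + a ^ 2) * (1 + r ^ 2 / l ^ 2) ≤ (r ^ 2 + r ^ 2) * (1 + 1) := by gcongr
    have h₃ : M * r ≤ (2 * r) * r := by linarith
    linarith [le_of_mul_le_mul_right h₃ hr]

/-- The numerator of `-g^{t*t*}` is nonnegative and bounded by a multiple of `k₀²`. -/
lemma inverse_metric_numerator_bounds {M l a r s : ℝ} (hM : 0 < M) (hl : 0 < l) (ha : 0 < a)
    (hal : a < l) (hr : 0 < r) (hs₀ : 0 ≤ s) (hs₁ : s ≤ 1) :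
    0 ≤ (1 - a ^ 2 / l ^ 2) * ((r ^ 2 + a ^ 2) * (1 + r ^ 2 / l ^ 2) + 2 * M * r) +
        a ^ 2 * s * (-(1 + r ^ 2 / l ^ 2) * (1 - a ^ 2 / l ^ 2) + 2 * M * r / l ^ 2) ∧
    (1 - a ^ 2 / l ^ 2) * ((r ^ 2 + a ^ 2) * (1 + r ^ 2 / l ^ 2) + 2 * M * r) +
        a ^ 2 * s * (-(1 + r ^ 2 / l ^ 2) * (1 - a ^ 2 / l ^ 2) + 2 * M * r / l ^ 2) ≤
      2 * (l ^ 2 + M * l) * (1 + r ^ 2 / l ^ 2) ^ 2 := by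
  obtain ⟨e, rfl⟩ : ∃ e, a = l * e := ⟨a / l, by field_simp⟩
  obtain ⟨x, rfl⟩ : ∃ x, r = l * x := ⟨r / l, by field_simp⟩
  have he : 0 < e := pos_of_mul_pos_right ha hl.le
  have hx : 0 < x := pos_of_mul_pos_right hr hl.le
  have he₁ : e < 1 := by nlinarith
  have h₁ : (l * e) ^ 2 / l ^ 2 = e ^ 2 := by field_simp
  have h₂ : (l * x) ^ 2 / l ^ 2 = x ^ 2 := by field_simp
  have h₃ : (l * e) ^ 2 * s * (-(1 + x ^ 2) * (1 - e ^ 2) + 2 * M * (l * x) / l ^ 2) =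
      -(l ^ 2 * (e ^ 2 * s * (1 + x ^ 2) * (1 - e ^ 2))) + l * M * (2 * e ^ 2 * s * x) := by
    field_simp
  rw [h₁, h₂, h₃]
  have he₂ : e ^ 2 ≤ 1 := by nlinarith
  have hΞ : 0 ≤ 1 - e ^ 2 := by linarith
  have hs : 0 ≤ 1 - s := by linarith
  constructor
  · have : 0 ≤ l ^ 2 * (1 - e ^ 2) * (1 + x ^ 2) * (x ^ 2 + e ^ 2 * (1 - s)) +
        l * M * ((1 - e ^ 2) * (2 * x) + 2 * e ^ 2 * s * x) := by positivity
    linarith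
  · have hx₂ : 2 * x ≤ (1 + x ^ 2) ^ 2 := by nlinarith [sq_nonneg (x - 1), sq_nonneg (x ^ 2)]
    have hp : 0 ≤ l ^ 2 * (e ^ 2 * s * (1 + x ^ 2) * (1 - e ^ 2)) := by positivity
    have hq : e ^ 2 * s * (2 * x) ≤ 1 * 1 * (1 + x ^ 2) ^ 2 := by gcongr
    have hu : (1 - e ^ 2) * (2 * x) ≤ 1 * (1 + x ^ 2) ^ 2 := by
      gcongr
      nlinarith
    have hv : (1 - e ^ 2) * ((x ^ 2 + e ^ 2) * (1 + x ^ 2)) ≤ 1 * ((x ^ 2 + 1) * (1 + x ^ 2)) := by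
      gcongr
      nlinarith
    have hlM : 0 ≤ l * M := by positivity
    have := mul_le_mul_of_nonneg_left hq hlM
    have := mul_le_mul_of_nonneg_left hu hlM
    have := mul_le_mul_of_nonneg_left hv (sq_nonneg l)
    have : 0 ≤ l ^ 2 * (1 + x ^ 2) ^ 2 := by positivity
    linarith


/-- Condition (5.5): for slowly rotating Kerr-AdS there is `a₀ > 0` depending only on
`M` and `l` such that for all `0 < a < a₀`, all horizon radii `r_h` with
`Δ₋(r_h) = 0` and `a·l < r_h²`, all `r ≥ r_h`, `θ ∈ (0, π)` and all reals `X`, `Y`,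
the quadratic form
`(1/2)(−G)X² − G(2aΞ/(r_h² + a²))XY + (1/8)(Ξ²/(Δ_θΣ sin²θ))Y²` is nonnegative,
where `G = g^{t*t*}` is the inverse metric component of Kerr-AdS. -/
theorem kerr_ads_time_angular_cross_term (M l : ℝ) (hM : 0 < M) (hl : 0 < l) :
    ∃ a₀ : ℝ, 0 < a₀ ∧
      ∀ a : ℝ, 0 < a → a < a₀ →
        ∀ r_h : ℝ, 0 < r_h →
          (r_h ^ 2 + a ^ 2) * (1 + r_h ^ 2 / l ^ 2) - 2 * M * r_h = 0 →
          a * l < r_h ^ 2 →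
          ∀ r : ℝ, r_h ≤ r → ∀ θ : ℝ, θ ∈ Set.Ioo (0 : ℝ) Real.pi → ∀ X Y : ℝ,
            0 ≤ (1 / 2) *
                  (-(-(((1 - a ^ 2 / l ^ 2) * ((r ^ 2 + a ^ 2) * (1 + r ^ 2 / l ^ 2) + 2 * M * r) +
                        a ^ 2 * Real.sin θ ^ 2 *
                          (-(1 + r ^ 2 / l ^ 2) * (1 - a ^ 2 / l ^ 2) + 2 * M * r / l ^ 2)) /
                      ((1 + r ^ 2 / l ^ 2) ^ 2 * (1 - (a ^ 2 / l ^ 2) * Real.cos θ ^ 2) *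
                        (r ^ 2 + a ^ 2 * Real.cos θ ^ 2))))) * X ^ 2 -
                (-(((1 - a ^ 2 / l ^ 2) * ((r ^ 2 + a ^ 2) * (1 + r ^ 2 / l ^ 2) + 2 * M * r) +
                      a ^ 2 * Real.sin θ ^ 2 *
                        (-(1 + r ^ 2 / l ^ 2) * (1 - a ^ 2 / l ^ 2) + 2 * M * r / l ^ 2)) /
                    ((1 + r ^ 2 / l ^ 2) ^ 2 * (1 - (a ^ 2 / l ^ 2) * Real.cos θ ^ 2) *
                      (r ^ 2 + a ^ 2 * Real.cos θ ^ 2)))) *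
                  (2 * a * (1 - a ^ 2 / l ^ 2) / (r_h ^ 2 + a ^ 2)) * X * Y +
                (1 / 8) *
                  ((1 - a ^ 2 / l ^ 2) ^ 2 /
                    ((1 - (a ^ 2 / l ^ 2) * Real.cos θ ^ 2) *
                      (r ^ 2 + a ^ 2 * Real.cos θ ^ 2) * Real.sin θ ^ 2)) * Y ^ 2 := by
  have hm : 0 < min l (M / 2) := lt_min hl (by linarith)
  refine ⟨min l (M / 2) ^ 2 / (6 * (l + M)), by positivity, ?_⟩
  intro a ha ha₀ r_h hr_h hΔ hal r hr θ hθ X Y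
  have hmr := min_le_horizon_radius hl ha hr_h hΔ hal
  rw [lt_div_iff₀ (by positivity)] at ha₀
  have ha_l : a < l := by
    have h₁ : min l (M / 2) ^ 2 ≤ l ^ 2 := by
      gcongr
      exact min_le_left _ _
    by_contra! h
    nlinarith [mul_le_mul h h hl.le ha.le, mul_pos ha hM]
  have h_small : a * (6 * (l + M)) ≤ r_h ^ 2 + a ^ 2 := by
    have : min l (M / 2) ^ 2 ≤ r_h ^ 2 := by gcongr
    nlinarith [sq_nonneg a]
  have hr₀ : 0 < r := hr_h.trans_le hr
  have hsin : 0 < Real.sin θ := Real.sin_pos_of_mem_Ioo hθ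
  have hsc := Real.sin_sq_add_cos_sq θ
  have hs₁ : Real.sin θ ^ 2 ≤ 1 := by nlinarith [sq_nonneg (Real.cos θ)]
  have hc₁ : Real.cos θ ^ 2 ≤ 1 := by nlinarith [sq_nonneg (Real.sin θ)]
  have hε : a ^ 2 / l ^ 2 < 1 := by
    rw [div_lt_one (by positivity)]
    gcongr
  obtain ⟨hN₀, hN⟩ :=
    inverse_metric_numerator_bounds hM hl ha ha_l hr₀ (sq_nonneg (Real.sin θ)) hs₁
  have hD : 0 < 1 - a ^ 2 / l ^ 2 * Real.cos θ ^ 2 := by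
    have : 0 ≤ a ^ 2 / l ^ 2 := by positivity
    nlinarith [sq_nonneg (Real.cos θ)]
  have hS : 0 < r ^ 2 + a ^ 2 * Real.cos θ ^ 2 := by positivity
  have hK : 0 < 1 + r ^ 2 / l ^ 2 := by positivity
  generalize (1 - a ^ 2 / l ^ 2) * ((r ^ 2 + a ^ 2) * (1 + r ^ 2 / l ^ 2) + 2 * M * r) +
    a ^ 2 * Real.sin θ ^ 2 *
      (-(1 + r ^ 2 / l ^ 2) * (1 - a ^ 2 / l ^ 2) + 2 * M * r / l ^ 2) = N at *
  generalize 1 - a ^ 2 / l ^ 2 * Real.cos θ ^ 2 = D at *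
  generalize r ^ 2 + a ^ 2 * Real.cos θ ^ 2 = S at *
  generalize 1 + r ^ 2 / l ^ 2 = K at *
  generalize 1 - a ^ 2 / l ^ 2 = Ξ at *
  have hR : 0 < r_h ^ 2 + a ^ 2 := by positivity
  generalize r_h ^ 2 + a ^ 2 = R at *
  generalize Real.sin θ = s at *
  refine quadratic_form_nonneg (by positivity) ?_ X Y
  have key : 16 * N * a ^ 2 * s ^ 2 ≤ K ^ 2 * R ^ 2 := by
    calc 16 * N * a ^ 2 * s ^ 2
        ≤ 16 * (2 * (l ^ 2 + M * l) * K ^ 2) * a ^ 2 * 1 := by gcongr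
      _ ≤ K ^ 2 * (a * (6 * (l + M))) ^ 2 := by
        have : 0 ≤ K ^ 2 * a ^ 2 * (4 * l ^ 2 + 40 * (l * M) + 36 * M ^ 2) := by positivity
        linarith
      _ ≤ K ^ 2 * R ^ 2 := by gcongr
  calc 4 * (N / (K ^ 2 * D * S)) * (2 * a * Ξ / R) ^ 2
      = 16 * N * a ^ 2 * s ^ 2 * (Ξ ^ 2 / (K ^ 2 * R ^ 2 * (D * S * s ^ 2))) := by
        field_simp
        ring
    _ ≤ K ^ 2 * R ^ 2 * (Ξ ^ 2 / (K ^ 2 * R ^ 2 * (D * S * s ^ 2))) := by gcongr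
    _ = Ξ ^ 2 / (D * S * s ^ 2) := by field_simp
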